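/- Let n be a positive integer and let Λ₀ < p(n) and Π₀ be real numbers. There is a constant C = C(n, Λ₀, Π₀) > 0 with the following property: for every C² function f : (0,∞) → ℝ with f(t) > 0 for all t > 0, sup_{t>0} t f'(t)/f(t) ≤ Λ₀ and inf_{t>0} t² f''(t)/f(t) ≥ Π₀, every x₀ ∈ ℝⁿ, every R > 0, and every positive solution u of Δu + f(u) = 0 on B(x₀, 2R), one has sup_{B(x₀,R)} ( |∇u|²/u² + f(u)/u ) ≤ C / R². -/

import Mathlib

open Set Metric

/-- Euclidean space ℝⁿ. -/
abbrev E (n : ℕ) := EuclideanSpace ℝ (Fin n)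

/-- The Laplacian of `u : ℝⁿ → ℝ`: the sum of its second partial derivatives. -/
noncomputable def lap {n : ℕ} (u : E n → ℝ) (x : E n) : ℝ :=
  ∑ i : Fin n,
    iteratedFDeriv ℝ 2 u x ![EuclideanSpace.single i 1, EuclideanSpace.single i 1]

open Filter Topology

section Calculus

variable {F : Type*} [NormedAddCommGroup F] [NormedSpace ℝ F]

/-- The symmetric second difference quotients of a `C²` function converge to its second
derivative. -/
lemma ContDiffAt.tendsto_secondDifference {g : F → ℝ} {x : F} (hg : ContDiffAt ℝ 2 g x) (a : F) :
    Tendsto (fun τ : ℝ => (g (x + τ • a) + g (x - τ • a) - 2 * g x) / τ ^ 2) (𝓝[≠] 0)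
      (𝓝 (fderiv ℝ (fderiv ℝ g) x a a)) := by
  have hline : ∀ σ : ℝ, Tendsto (fun τ : ℝ => x + (σ * τ) • a) (𝓝 0) (𝓝 x) := by
    intro σ
    have : Continuous (fun τ : ℝ => x + (σ * τ) • a) := by fun_prop
    simpa using this.tendsto 0
  have hdiff : ∀ᶠ y in 𝓝 x, DifferentiableAt ℝ g y :=
    (hg.eventually (by simp)).mono fun y hy => hy.differentiableAt (by simp)
  have hd : ∀ σ : ℝ, ∀ᶠ τ in 𝓝 (0 : ℝ),
      HasDerivAt (fun τ : ℝ => g (x + (σ * τ) • a)) (σ * fderiv ℝ g (x + (σ * τ) • a) a) τ := by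
    intro σ
    filter_upwards [(hline σ).eventually hdiff] with τ hτ
    have h1 : HasDerivAt (fun τ : ℝ => x + (σ * τ) • a) (σ • a) τ := by
      have := (((hasDerivAt_id τ).const_mul σ).smul_const a).const_add x
      simpa using this
    have h2 := hτ.hasFDerivAt.comp_hasDerivAt τ h1
    rw [map_smul, smul_eq_mul] at h2
    exact h2
  have hD : DifferentiableAt ℝ (fderiv ℝ g) x :=
    (hg.fderiv_right (m := 1) (by norm_num)).differentiableAt (by simp)
  have hd2 : ∀ σ : ℝ, HasDerivAt (fun τ : ℝ => fderiv ℝ g (x + (σ * τ) • a) a)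
      (σ * fderiv ℝ (fderiv ℝ g) x a a) 0 := by
    intro σ
    have h1 : HasDerivAt (fun τ : ℝ => x + (σ * τ) • a) (σ • a) 0 := by
      have := (((hasDerivAt_id (0 : ℝ)).const_mul σ).smul_const a).const_add x
      simpa using this
    have h2 : HasFDerivAt (fun y => fderiv ℝ g y a)
        ((ContinuousLinearMap.apply ℝ ℝ a).comp (fderiv ℝ (fderiv ℝ g) x)) (x + (σ * 0) • a) := by
      rw [mul_zero, zero_smul, add_zero]
      exact (ContinuousLinearMap.apply ℝ ℝ a).hasFDerivAt.comp x hD.hasFDerivAt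
    have h3 := h2.comp_hasDerivAt (0 : ℝ) h1
    rw [map_smul, smul_eq_mul] at h3
    exact h3
  have key := HasDerivAt.lhopital_zero_nhdsNE (a := (0 : ℝ))
    (f := fun τ : ℝ => g (x + (1 * τ) • a) + g (x + (-1 * τ) • a) - 2 * g x)
    (f' := fun τ : ℝ => 1 * fderiv ℝ g (x + (1 * τ) • a) a + -1 * fderiv ℝ g (x + (-1 * τ) • a) a)
    (g := fun τ : ℝ => τ ^ 2) (g' := fun τ => 2 * τ)
    (l := 𝓝 (fderiv ℝ (fderiv ℝ g) x a a)) ?_ ?_ ?_ ?_ ?_ ?_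
  · refine key.congr fun τ => ?_
    simp [sub_eq_add_neg]
  · apply eventually_nhdsWithin_of_eventually_nhds
    filter_upwards [hd 1, hd (-1)] with τ h1 h2
    exact (h1.add h2).sub_const _
  · exact Eventually.of_forall fun τ => by simpa using hasDerivAt_pow 2 τ
  · filter_upwards [self_mem_nhdsWithin] with τ hτ
    simpa using hτ
  · apply tendsto_nhdsWithin_of_tendsto_nhds
    have hc := hg.continuousAt.tendsto
    have := ((hc.comp (hline 1)).add (hc.comp (hline (-1)))).sub_const (2 * g x)
    rwa [show g x + g x - 2 * g x = 0 by ring] at this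
  · apply tendsto_nhdsWithin_of_tendsto_nhds
    have : Continuous (fun τ : ℝ => τ ^ 2) := by fun_prop
    simpa using this.tendsto 0
  · have h := (((hd2 1).sub (hd2 (-1))).tendsto_slope_zero).const_mul (1 / 2)
    convert h using 2
    · simp
      field_simp
      ring
    · ring

lemma ContDiffAt.differentiableAt_deriv {φ : ℝ → ℝ} {t : ℝ} (hφ : ContDiffAt ℝ 2 φ t) :
    DifferentiableAt ℝ (deriv φ) t := by
  have h1 := (hφ.fderiv_right (m := 1) (by norm_num)).differentiableAt (by simp)
  have : deriv φ = fun y => fderiv ℝ φ y 1 := by ext y; simp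
  rw [this]
  exact h1.clm_apply (differentiableAt_const _)

lemma ContDiffAt.fderiv_fderiv_comp_apply {φ : ℝ → ℝ} {g : F → ℝ} {x : F}
    (hφ : ContDiffAt ℝ 2 φ (g x)) (hg : ContDiffAt ℝ 2 g x) (a b : F) :
    fderiv ℝ (fderiv ℝ (fun y => φ (g y))) x a b =
      deriv φ (g x) * fderiv ℝ (fderiv ℝ g) x a b
        + deriv (deriv φ) (g x) * (fderiv ℝ g x a * fderiv ℝ g x b) := by
  have hev : fderiv ℝ (fun y => φ (g y)) =ᶠ[𝓝 x] fun y => deriv φ (g y) • fderiv ℝ g y := by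
    filter_upwards [hg.continuousAt.eventually (hφ.eventually (by simp)),
      hg.eventually (by simp)] with y h1 h2
    exact ((h1.differentiableAt (by simp)).hasDerivAt.comp_hasFDerivAt y
      (h2.differentiableAt (by simp)).hasFDerivAt).fderiv
  have hD : DifferentiableAt ℝ (fderiv ℝ g) x :=
    (hg.fderiv_right (m := 1) (by norm_num)).differentiableAt (by simp)
  have h1 := hφ.differentiableAt_deriv.hasDerivAt.comp_hasFDerivAt x
    (hg.differentiableAt (by simp)).hasFDerivAt
  have h2 := h1.smul hD.hasFDerivAt
  have h3 : fderiv ℝ (fun y => deriv φ (g y) • fderiv ℝ g y) x = _ := h2.fderiv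
  rw [hev.fderiv_eq, h3]
  simp
  ring

end Calculus

section Laplacian

variable {n : ℕ}

lemma lap_eq_sum (g : E n → ℝ) (x : E n) :
    lap g x = ∑ i, fderiv ℝ (fderiv ℝ g) x (EuclideanSpace.single i 1)
      (EuclideanSpace.single i 1) := by
  simp [lap, iteratedFDeriv_two_apply]

lemma sum_sq_apply_single (L : E n →L[ℝ] ℝ) :
    ∑ i, L (EuclideanSpace.single i 1) * L (EuclideanSpace.single i 1) = ‖L‖ ^ 2 := by
  have h := (InnerProductSpace.toDual ℝ (E n)).symm.norm_map L
  rw [← h, EuclideanSpace.real_norm_sq_eq]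
  refine Finset.sum_congr rfl fun i _ => ?_
  have : L (EuclideanSpace.single i 1) = ((InnerProductSpace.toDual ℝ (E n)).symm L) i := by
    rw [← InnerProductSpace.toDual_symm_apply, EuclideanSpace.inner_single_right]
    simp
  rw [this]
  ring

lemma norm_gradient (g : E n → ℝ) (x : E n) : ‖gradient g x‖ = ‖fderiv ℝ g x‖ :=
  (InnerProductSpace.toDual ℝ (E n)).symm.norm_map _

lemma lap_comp {φ : ℝ → ℝ} {g : E n → ℝ} {x : E n}
    (hφ : ContDiffAt ℝ 2 φ (g x)) (hg : ContDiffAt ℝ 2 g x) :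
    lap (fun y => φ (g y)) x =
      deriv φ (g x) * lap g x + deriv (deriv φ) (g x) * ‖gradient g x‖ ^ 2 := by
  rw [lap_eq_sum, lap_eq_sum, norm_gradient, ← sum_sq_apply_single, Finset.mul_sum,
    Finset.mul_sum, ← Finset.sum_add_distrib]
  exact Finset.sum_congr rfl fun i _ => hφ.fderiv_fderiv_comp_apply hg _ _

end Laplacian

section MaximumPrinciple

variable {n : ℕ}

/-- The second derivative test for the two-point function comparing `w` at `x + t • p x` and
`x - t • p x`, where `p x = v + A (x - x₀)`. -/
lemma secondDerivative_nonneg_of_isLocalMin {w κ : E n → ℝ} {x₀ x₁ v : E n} {t c C : ℝ}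
    {A : E n →L[ℝ] E n}
    (hw₁ : ContDiffAt ℝ 2 w (x₁ + t • (v + A (x₁ - x₀))))
    (hw₂ : ContDiffAt ℝ 2 w (x₁ - t • (v + A (x₁ - x₀))))
    (hκ : ContDiffAt ℝ 2 κ x₁)
    (hmin : IsLocalMin (fun x => ‖v + A (x - x₀)‖ ^ 2 + (C - κ x)
      - (w (x + t • (v + A (x - x₀))) - w (x - t • (v + A (x - x₀)))) / t
      + c * ‖x - x₀‖ ^ 2) x₁) (a : E n) :
    0 ≤ 2 * ‖A a‖ ^ 2 - fderiv ℝ (fderiv ℝ κ) x₁ a a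
      - (fderiv ℝ (fderiv ℝ w) (x₁ + t • (v + A (x₁ - x₀))) (a + t • A a) (a + t • A a)
        - fderiv ℝ (fderiv ℝ w) (x₁ - t • (v + A (x₁ - x₀))) (a - t • A a) (a - t • A a)) / t
      + 2 * c * ‖a‖ ^ 2 := by
  have lim := (((hκ.tendsto_secondDifference a).const_sub (2 * ‖A a‖ ^ 2)).sub
    (((hw₁.tendsto_secondDifference (a + t • A a)).sub
      (hw₂.tendsto_secondDifference (a - t • A a))).div_const t)).add_const (2 * c * ‖a‖ ^ 2)
  refine ge_of_tendsto lim ?_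
  have hcont : ∀ σ : ℝ, Tendsto (fun τ : ℝ => x₁ + (σ * τ) • a) (𝓝[≠] 0) (𝓝 x₁) := by
    intro σ
    apply tendsto_nhdsWithin_of_tendsto_nhds
    have : Continuous (fun τ : ℝ => x₁ + (σ * τ) • a) := by fun_prop
    simpa using this.tendsto 0
  filter_upwards [(hcont 1).eventually hmin, (hcont (-1)).eventually hmin, self_mem_nhdsWithin]
    with τ h1 h2 hτ
  have hτ0 : τ ≠ 0 := hτ
  have hτ2 : 0 < τ ^ 2 := by positivity
  have hp : ∀ σ : ℝ, v + A (x₁ + (σ * τ) • a - x₀) = (v + A (x₁ - x₀)) + (σ * τ) • A a := by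
    intro σ
    rw [show x₁ + (σ * τ) • a - x₀ = (x₁ - x₀) + (σ * τ) • a by abel, map_add, map_smul, add_assoc]
  simp only [hp] at h1 h2
  set p := v + A (x₁ - x₀) with hpdef
  rw [show x₁ + (1 * τ) • a + t • (p + (1 * τ) • A a) = x₁ + t • p + τ • (a + t • A a) by module,
    show x₁ + (1 * τ) • a - t • (p + (1 * τ) • A a) = x₁ - t • p + τ • (a - t • A a) by module,
    show x₁ + (1 * τ) • a - x₀ = (x₁ - x₀) + τ • a by module,
    show x₁ + (1 * τ) • a = x₁ + τ • a by module,
    show p + (1 * τ) • A a = p + τ • A a by module] at h1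
  rw [show x₁ + (-1 * τ) • a + t • (p + (-1 * τ) • A a) = x₁ + t • p - τ • (a + t • A a) by module,
    show x₁ + (-1 * τ) • a - t • (p + (-1 * τ) • A a) = x₁ - t • p - τ • (a - t • A a) by module,
    show x₁ + (-1 * τ) • a - x₀ = (x₁ - x₀) - τ • a by module,
    show x₁ + (-1 * τ) • a = x₁ - τ • a by module,
    show p + (-1 * τ) • A a = p - τ • A a by module] at h2
  have n1 := parallelogram_law_with_norm ℝ p (τ • A a)
  have n2 := parallelogram_law_with_norm ℝ (x₁ - x₀) (τ • a)
  rw [norm_smul, Real.norm_eq_abs] at n1 n2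
  have hab : |τ| * |τ| = τ ^ 2 := by rw [abs_mul_abs_self, sq]
  have n1' : ‖p + τ • A a‖ ^ 2 + ‖p - τ • A a‖ ^ 2 = 2 * ‖p‖ ^ 2 + 2 * (τ ^ 2 * ‖A a‖ ^ 2) := by
    rw [← hab]; linarith
  have n2' : ‖x₁ - x₀ + τ • a‖ ^ 2 + ‖x₁ - x₀ - τ • a‖ ^ 2
      = 2 * ‖x₁ - x₀‖ ^ 2 + 2 * (τ ^ 2 * ‖a‖ ^ 2) := by
    rw [← hab]; linarith
  refine nonneg_of_mul_nonneg_right (a := τ ^ 2) ?_ hτ2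
  have key := add_le_add h1 h2
  have e : ∀ X Y Z b c d : ℝ, τ ^ 2 * (b - X / τ ^ 2 - (Y / τ ^ 2 - Z / τ ^ 2) / t + d)
      = τ ^ 2 * b - X - (Y - Z) / t + τ ^ 2 * d := by
    intro X Y Z b c d
    rw [show (Y / τ ^ 2 - Z / τ ^ 2) / t = (Y - Z) / t / τ ^ 2 by ring]
    generalize (Y - Z) / t = W
    field_simp
  rw [e _ _ _ _ c]
  have n2c : c * ‖x₁ - x₀ + τ • a‖ ^ 2 + c * ‖x₁ - x₀ - τ • a‖ ^ 2
      = 2 * (c * ‖x₁ - x₀‖ ^ 2) + τ ^ 2 * (2 * c * ‖a‖ ^ 2) := by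
    rw [← mul_add, n2']; ring
  simp only [sub_div, add_div, mul_div_assoc] at key ⊢
  linarith

lemma HasStrictFDerivAt.tendsto_symmetric_quotient {F : Type*} [NormedAddCommGroup F]
    [NormedSpace ℝ F] {G : F → ℝ} {g : F →L[ℝ] ℝ} {x₀ : F}
    (hG : HasStrictFDerivAt G g x₀) {p : F → F} (hp : ContinuousAt p x₀) :
    Tendsto (fun z : F × ℝ => (G (z.1 + z.2 • p z.1) - G (z.1 - z.2 • p z.1)) / z.2)
      (𝓝 x₀ ×ˢ 𝓝[>] 0) (𝓝 (2 * g (p x₀))) := by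
  have hfst : Tendsto (fun z : F × ℝ => z.1) (𝓝 x₀ ×ˢ 𝓝[>] (0 : ℝ)) (𝓝 x₀) := tendsto_fst
  have hsnd : Tendsto (fun z : F × ℝ => z.2) (𝓝 x₀ ×ˢ 𝓝[>] (0 : ℝ)) (𝓝 0) :=
    tendsto_nhdsWithin_iff.1 tendsto_snd |>.1
  have hpz := hp.tendsto.comp hfst
  have hplus := hfst.add (hsnd.smul hpz)
  have hminus := hfst.sub (hsnd.smul hpz)
  rw [zero_smul, add_zero] at hplus
  rw [zero_smul, sub_zero] at hminus
  have ho := hG.isLittleO.comp_tendsto (hplus.prodMk_nhds hminus)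
  have hO : (fun z : F × ℝ => (z.1 + z.2 • p z.1) - (z.1 - z.2 • p z.1))
      =O[𝓝 x₀ ×ˢ 𝓝[>] 0] fun z => z.2 := by
    have hb : (fun z : F × ℝ => p z.1) =O[𝓝 x₀ ×ˢ 𝓝[>] 0] fun _ => (1 : ℝ) :=
      hpz.isBigO_one ℝ
    have h := ((Asymptotics.isBigO_refl (fun z : F × ℝ => z.2) (𝓝 x₀ ×ˢ 𝓝[>] 0)).smul hb)
      |>.const_smul_left (2 : ℝ)
    refine (h.congr_left fun z => ?_).trans (Asymptotics.IsBigO.of_bound' ?_)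
    · change (2 : ℝ) • (z.2 • p z.1) = _
      module
    · simp
  have hq := (ho.trans_isBigO hO).tendsto_div_nhds_zero
  have hlin : Tendsto (fun z : F × ℝ => 2 * g (p z.1)) (𝓝 x₀ ×ˢ 𝓝[>] 0) (𝓝 (2 * g (p x₀))) :=
    ((g.continuous.tendsto _).comp hpz).const_mul 2
  have hsum := hq.add hlin
  rw [zero_add] at hsum
  refine hsum.congr' ?_
  have hpos : ∀ᶠ z in 𝓝 x₀ ×ˢ 𝓝[>] (0 : ℝ), 0 < z.2 :=
    tendsto_snd.eventually self_mem_nhdsWithin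
  filter_upwards [hpos] with z hz
  simp only [Function.comp]
  rw [show z.1 + z.2 • p z.1 - (z.1 - z.2 • p z.1) = (2 * z.2) • p z.1 by module, map_smul,
    smul_eq_mul]
  field_simp
  ring

lemma symmetric_quotient_le {w κ : E n → ℝ} {x p : E n} {t M K P : ℝ} (ht : 0 < t)
    (hw : ∀ s ∈ Icc (-t) t, DifferentiableAt ℝ w (x + s • p))
    (hle : ∀ s ∈ Icc (-t) t, ‖gradient w (x + s • p)‖ ^ 2 + κ (x + s • p) ≤ M)
    (hκ : ∀ s ∈ Icc (-t) t, κ x - κ (x + s • p) ≤ K * (t * P)) :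
    (w (x + t • p) - w (x - t • p)) / t ≤ ‖p‖ ^ 2 + (M + K * (t * P) - κ x) := by
  have hd : ∀ s ∈ Icc (-t) t,
      HasDerivAt (fun s : ℝ => w (x + s • p)) (fderiv ℝ w (x + s • p) p) s := by
    intro s hs
    have h1 : HasDerivAt (fun s : ℝ => x + s • p) p s := by
      simpa using ((hasDerivAt_id s).smul_const p).const_add x
    exact (hw s hs).hasFDerivAt.comp_hasDerivAt s h1
  obtain ⟨s, hs, hslope⟩ := exists_hasDerivAt_eq_slope (fun s : ℝ => w (x + s • p))
    (fun s => fderiv ℝ w (x + s • p) p) (show -t < t by linarith)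
    (fun s hs => (hd s hs).continuousAt.continuousWithinAt)
    (fun s hs => hd s (Ioo_subset_Icc_self hs))
  have hs' := Ioo_subset_Icc_self hs
  have h1 : fderiv ℝ w (x + s • p) p ≤ ‖gradient w (x + s • p)‖ * ‖p‖ := by
    rw [norm_gradient]
    exact (le_abs_self _).trans ((fderiv ℝ w (x + s • p)).le_opNorm p)
  have h2 := hle s hs'
  have h3 := hκ s hs'
  have h4 : (w (x + t • p) - w (x - t • p)) / t = 2 * fderiv ℝ w (x + s • p) p := by
    rw [hslope, neg_smul, ← sub_eq_add_neg]
    field_simp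
    ring
  rw [h4]
  nlinarith [sq_nonneg (‖gradient w (x + s • p)‖ - ‖p‖)]

lemma ContDiffAt.continuousAt_fderiv_fderiv_apply {F : Type*} [NormedAddCommGroup F]
    [NormedSpace ℝ F] {w : F → ℝ} {x₀ : F} (hw : ContDiffAt ℝ 2 w x₀) (a b : F) :
    ContinuousAt (fun y => fderiv ℝ (fderiv ℝ w) y a b) x₀ := by
  have h := ((hw.fderiv_right (m := 1) (by norm_num)).fderiv_right (m := 0)
    (by norm_num)).continuousAt
  exact (h.clm_apply continuousAt_const).clm_apply continuousAt_const

/-- **Maximum principle for Bernstein functions.** If `w` is `C²` and its Laplacian is strictly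
differentiable at a local maximum point of `|∇w|² + κ`, then the expression obtained by formally
differentiating `|∇w|² + κ` twice is nonpositive there. The term `2|D²w|²` is replaced by its
lower bound `4 tr (D²w A) - 2|A|²`. -/
theorem bernstein_maximum_principle {w κ : E n → ℝ} {x₀ : E n} {M : ℝ} {g : E n →L[ℝ] ℝ}
    (hw : ContDiffAt ℝ 2 w x₀) (hκ : ContDiffAt ℝ 2 κ x₀) (hg : HasStrictFDerivAt (lap w) g x₀)
    (hle : ∀ᶠ x in 𝓝 x₀, ‖gradient w x‖ ^ 2 + κ x ≤ M)
    (heq : ‖gradient w x₀‖ ^ 2 + κ x₀ = M) (A : E n →L[ℝ] E n) :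
    2 * ∑ i, (fderiv ℝ (fderiv ℝ w) x₀ (EuclideanSpace.single i 1)
            (A (EuclideanSpace.single i 1))
          + fderiv ℝ (fderiv ℝ w) x₀ (A (EuclideanSpace.single i 1))
            (EuclideanSpace.single i 1))
      - 2 * ∑ i, ‖A (EuclideanSpace.single i 1)‖ ^ 2
      + 2 * g (gradient w x₀) + lap κ x₀ ≤ 0 := by
  set e : Fin n → E n := fun i => EuclideanSpace.single i 1 with he
  have hlapw : ∀ y, lap w y = ∑ i, fderiv ℝ (fderiv ℝ w) y (e i) (e i) := lap_eq_sum w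
  have hlapκ : ∀ y, lap κ y = ∑ i, fderiv ℝ (fderiv ℝ κ) y (e i) (e i) := lap_eq_sum κ
  set v := gradient w x₀ with hv
  set p : E n → E n := fun x => v + A (x - x₀) with hp
  have hpx₀ : p x₀ = v := by simp [hp]
  have hpc : Continuous p := by fun_prop
  set Ψ : E n × ℝ → ℝ := fun z => 2 * ∑ i, ‖A (e i)‖ ^ 2 - lap κ z.1
      - (lap w (z.1 + z.2 • p z.1) - lap w (z.1 - z.2 • p z.1)) / z.2
      - ∑ i, (fderiv ℝ (fderiv ℝ w) (z.1 + z.2 • p z.1) (e i) (A (e i))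
        + fderiv ℝ (fderiv ℝ w) (z.1 - z.2 • p z.1) (e i) (A (e i))
        + (fderiv ℝ (fderiv ℝ w) (z.1 + z.2 • p z.1) (A (e i)) (e i)
        + fderiv ℝ (fderiv ℝ w) (z.1 - z.2 • p z.1) (A (e i)) (e i))
        + z.2 * (fderiv ℝ (fderiv ℝ w) (z.1 + z.2 • p z.1) (A (e i)) (A (e i))
        - fderiv ℝ (fderiv ℝ w) (z.1 - z.2 • p z.1) (A (e i)) (A (e i)))) with hΨ
  by_contra! hpos
  set L := 2 * ∑ i, (fderiv ℝ (fderiv ℝ w) x₀ (e i) (A (e i))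
          + fderiv ℝ (fderiv ℝ w) x₀ (A (e i)) (e i))
      - 2 * ∑ i, ‖A (e i)‖ ^ 2 + 2 * g v + lap κ x₀ with hL
  have hfst : Tendsto (fun z : E n × ℝ => z.1) (𝓝 x₀ ×ˢ 𝓝[>] (0 : ℝ)) (𝓝 x₀) := tendsto_fst
  have hsnd : Tendsto (fun z : E n × ℝ => z.2) (𝓝 x₀ ×ˢ 𝓝[>] (0 : ℝ)) (𝓝 0) :=
    tendsto_nhdsWithin_iff.1 tendsto_snd |>.1
  have hpz := (hpc.tendsto x₀).comp hfst
  have hplus := hfst.add (hsnd.smul hpz)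
  have hminus := hfst.sub (hsnd.smul hpz)
  rw [zero_smul, add_zero] at hplus
  rw [zero_smul, sub_zero] at hminus
  have hlim : Tendsto Ψ (𝓝 x₀ ×ˢ 𝓝[>] 0) (𝓝 (-L)) := by
    have hκc : ContinuousAt (lap κ) x₀ := by
      have : lap κ = fun y => ∑ i, fderiv ℝ (fderiv ℝ κ) y (e i) (e i) := funext hlapκ
      rw [this]
      exact tendsto_finsetSum _ fun i _ => hκ.continuousAt_fderiv_fderiv_apply _ _
    have hwp : ∀ a b, Tendsto (fun z : E n × ℝ => fderiv ℝ (fderiv ℝ w) (z.1 + z.2 • p z.1) a b)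
        (𝓝 x₀ ×ˢ 𝓝[>] 0) (𝓝 (fderiv ℝ (fderiv ℝ w) x₀ a b)) := fun a b =>
      (hw.continuousAt_fderiv_fderiv_apply a b).tendsto.comp hplus
    have hwm : ∀ a b, Tendsto (fun z : E n × ℝ => fderiv ℝ (fderiv ℝ w) (z.1 - z.2 • p z.1) a b)
        (𝓝 x₀ ×ˢ 𝓝[>] 0) (𝓝 (fderiv ℝ (fderiv ℝ w) x₀ a b)) := fun a b =>
      (hw.continuousAt_fderiv_fderiv_apply a b).tendsto.comp hminus
    have h := (((hκc.tendsto.comp hfst).const_sub (2 * ∑ i, ‖A (e i)‖ ^ 2)).sub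
      (hg.tendsto_symmetric_quotient hpc.continuousAt)).sub
      (tendsto_finsetSum Finset.univ fun i _ =>
        (((hwp (e i) (A (e i))).add (hwm (e i) (A (e i)))).add
          ((hwp (A (e i)) (e i)).add (hwm (A (e i)) (e i)))).add
          (hsnd.mul ((hwp (A (e i)) (A (e i))).sub (hwm (A (e i)) (A (e i))))))
    refine (h.congr fun z => rfl).trans_eq ?_
    congr 1
    rw [hL, hpx₀]
    have : ∑ i, (fderiv ℝ (fderiv ℝ w) x₀ (e i) (A (e i))
          + fderiv ℝ (fderiv ℝ w) x₀ (e i) (A (e i))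
          + (fderiv ℝ (fderiv ℝ w) x₀ (A (e i)) (e i)
          + fderiv ℝ (fderiv ℝ w) x₀ (A (e i)) (e i))
          + 0 * (fderiv ℝ (fderiv ℝ w) x₀ (A (e i)) (A (e i))
          - fderiv ℝ (fderiv ℝ w) x₀ (A (e i)) (A (e i))))
        = 2 * ∑ i, (fderiv ℝ (fderiv ℝ w) x₀ (e i) (A (e i))
          + fderiv ℝ (fderiv ℝ w) x₀ (A (e i)) (e i)) := by
      rw [Finset.mul_sum]
      exact Finset.sum_congr rfl fun i _ => by ring
    rw [this]
    ring
  obtain ⟨pa, hpa, pb, hpb, hab⟩ := eventually_prod_iff.1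
    (hlim.eventually (gt_mem_nhds (show -L < -L / 2 by linarith)))
  obtain ⟨K, U, hU, hLip⟩ := (hκ.of_le (by norm_num : (1 : WithTop ℕ∞) ≤ 2)).exists_lipschitzOnWith
  obtain ⟨ρ, hρ, hball⟩ := Metric.eventually_nhds_iff_ball.1
    (hpa.and ((hw.eventually (by simp)).and ((hκ.eventually (by simp)).and (hle.and hU))))
  set P := ‖v‖ + ‖A‖ * ρ + 1 with hP
  have hPpos : 0 < P := by positivity
  set c := L / (8 * (n + 1)) with hc
  have hcpos : 0 < c := by positivity
  have hpP : ∀ x ∈ ball x₀ ρ, ‖p x‖ ≤ P := by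
    intro x hx
    have h1 : ‖A (x - x₀)‖ ≤ ‖A‖ * ρ :=
      (A.le_opNorm _).trans (by
        gcongr
        rw [← dist_eq_norm]
        exact (mem_ball.1 hx).le)
    calc ‖p x‖ ≤ ‖v‖ + ‖A (x - x₀)‖ := norm_add_le _ _
      _ ≤ P := by linarith
  have hE0 : Tendsto (fun t : ℝ => ‖v‖ ^ 2 + (M + K * (t * P) - κ x₀)
      - (w (x₀ + t • v) - w (x₀ - t • v)) / t) (𝓝[>] 0) (𝓝 0) := by
    have h1 := ((hw.hasStrictFDerivAt (by simp)).tendsto_symmetric_quotient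
      hpc.continuousAt).comp (tendsto_const_nhds.prodMk tendsto_id : Tendsto
        (fun t : ℝ => (x₀, t)) (𝓝[>] 0) (𝓝 x₀ ×ˢ 𝓝[>] 0))
    have h2 : Continuous (fun t : ℝ => ‖v‖ ^ 2 + (M + K * (t * P) - κ x₀)) := by fun_prop
    have h3 := ((h2.tendsto 0).mono_left nhdsWithin_le_nhds).sub h1
    simp only [Function.comp_def, hpx₀] at h3
    convert h3 using 2
    have : fderiv ℝ w x₀ v = ‖v‖ ^ 2 := by
      rw [← real_inner_self_eq_norm_sq]
      conv_rhs => rw [hv, gradient]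
      rw [InnerProductSpace.toDual_symm_apply]
      rfl
    rw [this, ← heq]
    ring
  have hr : 0 < ρ / 2 := by positivity
  have hIoo : ∀ᶠ t in 𝓝[>] (0 : ℝ), t ∈ Ioo 0 (ρ / (2 * P)) :=
    Ioo_mem_nhdsGT (by positivity)
  obtain ⟨t, hEt, hbt, ht, htρ⟩ := ((hE0.eventually
    (gt_mem_nhds (show 0 < c * (ρ / 2) ^ 2 by positivity))).and (hpb.and hIoo)).exists
  have htP : t * P < ρ / 2 := by
    have h := (lt_div_iff₀ (by positivity)).1 htρ
    linarith
  have hsub : ∀ x ∈ closedBall x₀ (ρ / 2), x ∈ ball x₀ ρ := fun x hx =>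
    mem_ball.2 (lt_of_le_of_lt (mem_closedBall.1 hx) (by linarith))
  have hseg : ∀ x ∈ closedBall x₀ (ρ / 2), ∀ s ∈ Icc (-t) t,
      x + s • p x ∈ ball x₀ ρ ∧ ‖s • p x‖ ≤ t * P := by
    intro x hx s hs
    have h1 : ‖s • p x‖ ≤ t * P := by
      rw [norm_smul]
      exact mul_le_mul (abs_le.2 hs) (hpP x (hsub x hx)) (norm_nonneg _) ht.le
    refine ⟨?_, h1⟩
    rw [mem_ball, dist_eq_norm, add_sub_right_comm]
    have h2 : ‖x - x₀‖ ≤ ρ / 2 := by rw [← dist_eq_norm]; exact hx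
    exact (norm_add_le _ _).trans_lt (by linarith)
  have htmem : t ∈ Icc (-t) t := ⟨by linarith, le_rfl⟩
  have htmem' : -t ∈ Icc (-t) t := ⟨le_rfl, by linarith⟩
  have hplus' : ∀ x ∈ closedBall x₀ (ρ / 2), ContDiffAt ℝ 2 w (x + t • p x) := fun x hx =>
    (hball _ (hseg x hx t htmem).1).2.1
  have hminus' : ∀ x ∈ closedBall x₀ (ρ / 2), ContDiffAt ℝ 2 w (x - t • p x) := fun x hx => by
    have := (hball _ (hseg x hx (-t) htmem').1).2.1
    rwa [neg_smul, ← sub_eq_add_neg] at this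
  have hnonneg : ∀ x ∈ closedBall x₀ (ρ / 2),
      (w (x + t • p x) - w (x - t • p x)) / t ≤ ‖p x‖ ^ 2 + (M + K * (t * P) - κ x) := by
    intro x hx
    refine symmetric_quotient_le ht
      (fun s hs => (hball _ (hseg x hx s hs).1).2.1.differentiableAt (by simp))
      (fun s hs => (hball _ (hseg x hx s hs).1).2.2.2.1) fun s hs => ?_
    have h1 := hLip.dist_le_mul x (hball x (hsub x hx)).2.2.2.2 _
      (hball _ (hseg x hx s hs).1).2.2.2.2
    rw [dist_self_add_right, Real.dist_eq] at h1
    exact (le_abs_self _).trans (h1.trans (by gcongr; exact (hseg x hx s hs).2))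
  set Φ : E n → ℝ := fun x => ‖p x‖ ^ 2 + (M + K * (t * P) - κ x)
      - (w (x + t • p x) - w (x - t • p x)) / t + c * ‖x - x₀‖ ^ 2 with hΦ
  have hΦc : ContinuousOn Φ (closedBall x₀ (ρ / 2)) := by
    intro x hx
    apply ContinuousAt.continuousWithinAt
    have h1 : ContinuousAt (fun x => w (x + t • p x)) x :=
      ContinuousAt.comp (f := fun x => x + t • p x) (hplus' x hx).continuousAt (by fun_prop)
    have h2 : ContinuousAt (fun x => w (x - t • p x)) x :=
      ContinuousAt.comp (f := fun x => x - t • p x) (hminus' x hx).continuousAt (by fun_prop)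
    have h3 : ContinuousAt κ x := (hball x (hsub x hx)).2.2.1.continuousAt
    fun_prop
  obtain ⟨x₁, hx₁, hmin⟩ := (isCompact_closedBall x₀ (ρ / 2)).exists_isMinOn
    ⟨x₀, mem_closedBall_self hr.le⟩ hΦc
  have hx₁' : x₁ ∈ ball x₀ (ρ / 2) := by
    by_contra hnot
    have hd : ‖x₁ - x₀‖ = ρ / 2 := by
      rw [← dist_eq_norm]
      exact le_antisymm hx₁ (not_lt.1 hnot)
    have h1 := hnonneg x₁ hx₁
    have h2 : Φ x₁ ≤ Φ x₀ := hmin (mem_closedBall_self hr.le)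
    have h3 : c * (ρ / 2) ^ 2 ≤ Φ x₁ := by
      simp only [hΦ, hd]
      linarith
    have h4 : Φ x₀ < c * (ρ / 2) ^ 2 := by
      simpa [hΦ, hpx₀] using hEt
    linarith
  have hloc : IsLocalMin Φ x₁ :=
    hmin.isLocalMin (Filter.mem_of_superset (isOpen_ball.mem_nhds hx₁') ball_subset_closedBall)
  have hdir := fun i => secondDerivative_nonneg_of_isLocalMin (hplus' x₁ hx₁) (hminus' x₁ hx₁)
    (hball x₁ (hsub x₁ hx₁)).2.2.1 hloc (e i)
  have hsum := Finset.sum_nonneg (s := Finset.univ) fun i _ => hdir i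
  have hΨ1 : Ψ (x₁, t) < -L / 2 := hab (hball x₁ (hsub x₁ hx₁)).1 hbt
  have hexp : ∀ i, (2 * ‖A (e i)‖ ^ 2 - fderiv ℝ (fderiv ℝ κ) x₁ (e i) (e i)
      - (fderiv ℝ (fderiv ℝ w) (x₁ + t • (v + A (x₁ - x₀))) (e i + t • A (e i)) (e i + t • A (e i))
        - fderiv ℝ (fderiv ℝ w) (x₁ - t • (v + A (x₁ - x₀))) (e i - t • A (e i))
          (e i - t • A (e i))) / t + 2 * c * ‖e i‖ ^ 2)
      = 2 * ‖A (e i)‖ ^ 2 - fderiv ℝ (fderiv ℝ κ) x₁ (e i) (e i)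
      - (fderiv ℝ (fderiv ℝ w) (x₁ + t • p x₁) (e i) (e i)
        - fderiv ℝ (fderiv ℝ w) (x₁ - t • p x₁) (e i) (e i)) / t
      - (fderiv ℝ (fderiv ℝ w) (x₁ + t • p x₁) (e i) (A (e i))
        + fderiv ℝ (fderiv ℝ w) (x₁ - t • p x₁) (e i) (A (e i))
        + (fderiv ℝ (fderiv ℝ w) (x₁ + t • p x₁) (A (e i)) (e i)
        + fderiv ℝ (fderiv ℝ w) (x₁ - t • p x₁) (A (e i)) (e i))
        + t * (fderiv ℝ (fderiv ℝ w) (x₁ + t • p x₁) (A (e i)) (A (e i))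
        - fderiv ℝ (fderiv ℝ w) (x₁ - t • p x₁) (A (e i)) (A (e i)))) + 2 * c := by
    intro i
    have hei : ‖e i‖ = 1 := by simp [he]
    rw [hei]
    simp only [hp, map_add, map_sub, map_smul, _root_.add_apply,
      _root_.sub_apply, _root_.smul_apply, smul_eq_mul]
    field_simp
    ring
  rw [Finset.sum_congr rfl fun i _ => hexp i] at hsum
  simp only [Finset.sum_add_distrib, Finset.sum_sub_distrib, ← Finset.sum_div,
    ← Finset.mul_sum, Finset.sum_const, Finset.card_univ, Fintype.card_fin, nsmul_eq_mul,
    ← hlapw, ← hlapκ] at hsum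
  simp only [hΨ, Finset.sum_add_distrib, Finset.sum_sub_distrib, ← Finset.mul_sum] at hΨ1
  have hcn : (n : ℝ) * (2 * c) ≤ L / 4 := by
    have h1 : c * (8 * (n + 1)) = L := by rw [hc]; field_simp
    nlinarith
  linarith

end MaximumPrinciple

section Specialization

variable {n : ℕ}

lemma sum_coord_mul_apply_single (L : E n →L[ℝ] ℝ) (e : E n) :
    ∑ i, e i * L (EuclideanSpace.single i 1) = L e := by
  conv_rhs => rw [← (EuclideanSpace.basisFun (Fin n) ℝ).sum_repr e]
  simp

/-- The Bernstein maximum principle, with `|D²w|²` bounded below by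
`T² + (Δw - T)² / m`, where `T` is the second derivative of `w` in the direction `e`. -/
theorem bernstein_maximum_principle_direction {w κ : E n → ℝ} {x₀ e : E n} {M m : ℝ}
    {g : E n →L[ℝ] ℝ}
    (hw : ContDiffAt ℝ 2 w x₀) (hκ : ContDiffAt ℝ 2 κ x₀) (hg : HasStrictFDerivAt (lap w) g x₀)
    (hle : ∀ᶠ x in 𝓝 x₀, ‖gradient w x‖ ^ 2 + κ x ≤ M)
    (heq : ‖gradient w x₀‖ ^ 2 + κ x₀ = M) (he : ‖e‖ = 1) (hm : 0 < m) (hnm : (n : ℝ) - 1 ≤ m) :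
    (fderiv ℝ (fderiv ℝ w) x₀ e e) ^ 2 + (lap w x₀ - fderiv ℝ (fderiv ℝ w) x₀ e e) ^ 2 / m
      + g (gradient w x₀) + lap κ x₀ / 2 ≤ 0 := by
  set T := fderiv ℝ (fderiv ℝ w) x₀ e e with hT
  set S := lap w x₀ with hS
  set β := (S - T) / m with hβ
  set γ := T - β with hγ
  set A : E n →L[ℝ] E n := β • ContinuousLinearMap.id ℝ (E n) + γ • (innerSL ℝ e).smulRight e
    with hA
  have key := bernstein_maximum_principle hw hκ hg hle heq A
  have hAe : ∀ i : Fin n, A (EuclideanSpace.single i 1)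
      = β • EuclideanSpace.single i 1 + (γ * e i) • e := by
    intro i
    simp [hA, EuclideanSpace.inner_single_right, mul_smul]
  have h1 : ∑ i, (fderiv ℝ (fderiv ℝ w) x₀ (EuclideanSpace.single i 1)
            (A (EuclideanSpace.single i 1))
          + fderiv ℝ (fderiv ℝ w) x₀ (A (EuclideanSpace.single i 1))
            (EuclideanSpace.single i 1)) = 2 * (β * S + γ * T) := by
    have e1 : ∑ i, e i * fderiv ℝ (fderiv ℝ w) x₀ (EuclideanSpace.single i 1) e = T := by
      simpa using sum_coord_mul_apply_single ((ContinuousLinearMap.apply ℝ ℝ e).comp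
        (fderiv ℝ (fderiv ℝ w) x₀)) e
    have e2 : ∑ i, e i * fderiv ℝ (fderiv ℝ w) x₀ e (EuclideanSpace.single i 1) = T :=
      sum_coord_mul_apply_single (fderiv ℝ (fderiv ℝ w) x₀ e) e
    have e3 := lap_eq_sum w x₀
    calc _ = ∑ i, (2 * (β * fderiv ℝ (fderiv ℝ w) x₀ (EuclideanSpace.single i 1)
              (EuclideanSpace.single i 1))
            + γ * (e i * fderiv ℝ (fderiv ℝ w) x₀ (EuclideanSpace.single i 1) e)
            + γ * (e i * fderiv ℝ (fderiv ℝ w) x₀ e (EuclideanSpace.single i 1))) := by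
          refine Finset.sum_congr rfl fun i _ => ?_
          rw [hAe]
          simp only [map_add, map_smul, _root_.add_apply, _root_.smul_apply, smul_eq_mul]
          ring
      _ = _ := by
          simp only [Finset.sum_add_distrib, ← Finset.mul_sum]
          rw [e1, e2, ← e3]
          ring
  have h2 : ∑ i, ‖A (EuclideanSpace.single i 1)‖ ^ 2 = n * β ^ 2 + 2 * β * γ + γ ^ 2 := by
    have e1 : ∑ i, e i ^ 2 = 1 := by
      rw [← EuclideanSpace.real_norm_sq_eq, he, one_pow]
    calc _ = ∑ i, (β ^ 2 + (2 * β * γ + γ ^ 2) * e i ^ 2) := by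
          refine Finset.sum_congr rfl fun i _ => ?_
          rw [hAe, norm_add_sq_real, norm_smul, norm_smul, he, inner_smul_left, inner_smul_right,
            EuclideanSpace.inner_single_left, mul_pow, mul_pow]
          simp [mul_pow, sq_abs]
          ring
      _ = _ := by
          rw [Finset.sum_add_distrib, ← Finset.mul_sum, e1]
          simp
          ring
  rw [h1, h2] at key
  have h3 : m * β = S - T := by rw [hβ]; field_simp
  have h4 : (S - T) ^ 2 / m = m * β ^ 2 := by rw [← h3]; field_simp
  rw [h4]
  have h5 : S = m * β + T := by linarith
  rw [h5, hγ] at key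
  linarith [mul_le_mul_of_nonneg_right hnm (sq_nonneg β)]

end Specialization

section Algebra

lemma le_of_mul_sq_le_add {c N Q q ω : ℝ} (hc : 0 < c) (hQ : 0 < Q)
    (hq : q ^ 2 ≤ 16 * Q ^ 3 * ω ^ 2) (h : c * Q ^ 2 ≤ q + N * Q * ω ^ 2) :
    Q ≤ 2 / c * (8 / c + N) * ω ^ 2 := by
  have h1 : q ≤ c * Q ^ 2 / 2 + 8 * Q * ω ^ 2 / c := by
    apply le_of_abs_le
    apply abs_le_of_sq_le_sq _ (by positivity)
    have h2 : (c * Q ^ 2 / 2 + 8 * Q * ω ^ 2 / c) ^ 2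
        = 16 * Q ^ 3 * ω ^ 2 + (c * Q ^ 2 / 2 - 8 * Q * ω ^ 2 / c) ^ 2 := by
      field_simp
      ring
    rw [h2]
    linarith [sq_nonneg (c * Q ^ 2 / 2 - 8 * Q * ω ^ 2 / c)]
  have h3 : Q * (c / 2 * Q) ≤ Q * ((8 / c + N) * ω ^ 2) := by
    have : Q * ((8 / c + N) * ω ^ 2) = 8 * Q * ω ^ 2 / c + N * Q * ω ^ 2 := by ring
    rw [this]
    linarith
  have h4 := le_of_mul_le_mul_left h3 hQ
  calc Q = 2 / c * (c / 2 * Q) := by field_simp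
    _ ≤ 2 / c * ((8 / c + N) * ω ^ 2) := by gcongr
    _ = _ := by ring

/-- Absorption estimate away from critical points. -/
lemma quadratic_lower_bound_of_gradient {m A P d θ y h a μ z τ : ℝ} (hm : 0 < m) (hA : 0 ≤ A)
    (hP : 0 ≤ P) (hd : 0 < d) (hθ : 0 < θ) (hθ1 : θ ≤ 1) (hdA : d * A ≤ 1) (hy : 0 ≤ y)
    (hh : 0 ≤ h) (ha : a ≤ A) (hμ : -P ≤ μ) (hz : z = d * a / 2) :
    (1 - θ - d * A - m * A / 4 - m * d * A / 2 - d * m * P / 8) * (y + h) ^ 2 - τ ^ 2 / θ ≤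
      (y + h - z * h + τ) ^ 2 + m * (-(h * a * y) + d / 2 * μ * (h * y) - d / 2 * h ^ 2 * a) := by
  have hzA : z ≤ d * A / 2 := by rw [hz]; linarith [mul_le_mul_of_nonneg_left ha hd.le]
  have hhy : 0 ≤ h * y := mul_nonneg hh hy
  have hhy4 : h * y ≤ (y + h) ^ 2 / 4 := by nlinarith [sq_nonneg (y - h)]
  have hhh : h ^ 2 ≤ (y + h) ^ 2 := by nlinarith [sq_nonneg y]
  have s1 : (1 - θ) * (y + h - z * h) ^ 2 - τ ^ 2 / θ ≤ (y + h - z * h + τ) ^ 2 := by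
    have : (y + h - z * h + τ) ^ 2 - ((1 - θ) * (y + h - z * h) ^ 2 - τ ^ 2 / θ)
        = (θ * (y + h - z * h) + τ) ^ 2 / θ + τ ^ 2 := by
      field_simp
      ring
    have h2 : 0 ≤ (θ * (y + h - z * h) + τ) ^ 2 / θ + τ ^ 2 := by positivity
    linarith
  have s2 : (1 - d * A) * (y + h) ^ 2 ≤ (y + h - z * h) ^ 2 := by
    have h1 : (1 - d * A / 2) * (y + h) ≤ y + h - z * h := by
      have := mul_le_mul_of_nonneg_right hzA hh
      have : 0 ≤ d * A / 2 * y := by positivity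
      linarith
    have h2 : 0 ≤ (1 - d * A / 2) * (y + h) := mul_nonneg (by linarith) (by linarith)
    have h3 := pow_le_pow_left₀ h2 h1 2
    have h4 : 0 ≤ (d * A / 2) ^ 2 * (y + h) ^ 2 := by positivity
    linarith
  have s3 : (1 - θ - d * A) * (y + h) ^ 2 ≤ (1 - θ) * (y + h - z * h) ^ 2 := by
    have h1 := mul_le_mul_of_nonneg_left s2 (show 0 ≤ 1 - θ by linarith)
    have h2 : 0 ≤ θ * (d * A) * (y + h) ^ 2 := by positivity
    linarith
  have s4 : -(A / 4 * (y + h) ^ 2) ≤ -(h * a * y) := by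
    have h1 := mul_le_mul_of_nonneg_right ha hhy
    have h2 := mul_le_mul_of_nonneg_left hhy4 hA
    linarith
  have s5 : -(d * P / 8 * (y + h) ^ 2) ≤ d / 2 * μ * (h * y) := by
    have h1 := mul_le_mul_of_nonneg_right hμ (show 0 ≤ d / 2 * (h * y) by positivity)
    have h2 := mul_le_mul_of_nonneg_left hhy4 (show 0 ≤ d / 2 * P by positivity)
    linarith
  have s6 : -(d * A / 2 * (y + h) ^ 2) ≤ -(d / 2 * h ^ 2 * a) := by
    have h1 := mul_le_mul_of_nonneg_right ha (show 0 ≤ d / 2 * h ^ 2 by positivity)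
    have h2 := mul_le_mul_of_nonneg_left hhh (show 0 ≤ d * A / 2 by positivity)
    linarith
  have s7 := mul_le_mul_of_nonneg_left (add_le_add (add_le_add s4 s5) s6) hm.le
  linarith

/-- Absorption estimate where the gradient is small. -/
lemma quadratic_lower_bound_of_small_gradient {m A P d ε y h a μ T : ℝ} (hm : 0 < m) (hA : 0 ≤ A)
    (hP : 0 ≤ P) (hd : 0 < d) (hε : 0 ≤ ε) (hy : 0 ≤ y) (hh : 0 ≤ h) (hyh : y ≤ ε * h)
    (ha : a ≤ A) (hμ : -P ≤ μ) :
    (1 / (m + 1) - A * ε - d / 2 * P * ε - d / 2 * A) * (y + h) ^ 2 ≤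
      T ^ 2 + (y + h + T) ^ 2 / m - h * a * y + d / 2 * μ * (h * y) - d / 2 * h ^ 2 * a := by
  have hhy : 0 ≤ h * y := mul_nonneg hh hy
  have hhh : h ^ 2 ≤ (y + h) ^ 2 := by nlinarith [sq_nonneg y]
  have hhy' : h * y ≤ ε * (y + h) ^ 2 := by
    linarith [mul_le_mul_of_nonneg_left hyh hh, mul_nonneg hε (mul_nonneg hh hy),
      mul_nonneg hε (sq_nonneg y)]
  have s1 : 1 / (m + 1) * (y + h) ^ 2 ≤ T ^ 2 + (y + h + T) ^ 2 / m := by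
    have : T ^ 2 + (y + h + T) ^ 2 / m - 1 / (m + 1) * (y + h) ^ 2
        = ((m + 1) * T + (y + h)) ^ 2 / (m * (m + 1)) := by
      field_simp
      ring
    have h2 : 0 ≤ ((m + 1) * T + (y + h)) ^ 2 / (m * (m + 1)) := by positivity
    linarith
  have h1 := mul_le_mul_of_nonneg_right ha hhy
  have h2 := mul_le_mul_of_nonneg_left hhy' hA
  have h3 := mul_le_mul_of_nonneg_right hμ (show 0 ≤ d / 2 * (h * y) by positivity)
  have h4 := mul_le_mul_of_nonneg_left hhy' (show 0 ≤ d / 2 * P by positivity)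
  have h5 := mul_le_mul_of_nonneg_right ha (show 0 ≤ d / 2 * h ^ 2 by positivity)
  have h6 := mul_le_mul_of_nonneg_left hhh (show 0 ≤ d * A / 2 by positivity)
  linarith

/-- The algebraic core of the gradient estimate: the differential inequality at a maximum point
bounds `Q = y + d h` by a multiple of the squared logarithmic derivative of the cutoff. -/
lemma exists_bound_of_max_point_inequality {m A P N : ℝ} (hm : 0 < m) (hA : 0 ≤ A)
    (hmA : m * A < 4) (hP : 0 ≤ P) (hN : 0 ≤ N) :
    ∃ d : ℝ, 0 < d ∧ d ≤ 1 ∧ ∃ C : ℝ, 0 < C ∧ ∀ y h a μ T q ω Q : ℝ,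
      0 ≤ y → 0 < h → a ≤ A → -P ≤ μ → Q = y + d * h →
      2 * (y * T) = -(d * h * a * y) + q → q ^ 2 ≤ 16 * Q ^ 2 * ω ^ 2 * y →
      T ^ 2 + (-(y + h) - T) ^ 2 / m + -(2 * (y * T) + h * a * y)
        + d / 2 * (h * y * (μ - 2 * a) - h ^ 2 * a) ≤ N * Q * ω ^ 2 →
      Q ≤ C * ω ^ 2 := by
  obtain ⟨δ, hδ⟩ : ∃ t, t = 1 - m * A / 4 := ⟨_, rfl⟩
  have hδ0 : 0 < δ := by linarith
  have hδ1 : δ ≤ 1 := by have := mul_nonneg hm.le hA; linarith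
  obtain ⟨D, hD⟩ : ∃ t, t = 8 * (m + 1) * (A + P + 1) := ⟨_, rfl⟩
  have hD0 : 0 < D := by rw [hD]; positivity
  obtain ⟨d, hd⟩ : ∃ t, t = δ / D := ⟨_, rfl⟩
  have hd0 : 0 < d := by rw [hd]; positivity
  have hdD : d * D = δ := by rw [hd]; field_simp
  obtain ⟨ε, hε⟩ : ∃ t, t = 1 / (4 * (m + 1) * (A + 1)) := ⟨_, rfl⟩
  have hε0 : 0 < ε := by rw [hε]; positivity
  have hmA0 : 0 ≤ m * A := by positivity
  have hmP0 : 0 ≤ m * P := by positivity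
  have hd1 : d ≤ 1 := by
    have : d * ((m + 1) * (A + P + 1)) = δ / 8 := by rw [← hdD, hD]; ring
    linarith [mul_nonneg hd0.le hA, mul_nonneg hd0.le hP, mul_nonneg hd0.le hmA0,
      mul_nonneg hd0.le hmP0, mul_pos hd0 hm]
  have hdA : d * A ≤ 1 := by
    have : d * ((m + 1) * (A + P + 1)) = δ / 8 := by rw [← hdD, hD]; ring
    linarith [mul_nonneg hd0.le hA, mul_nonneg hd0.le hP, mul_nonneg hd0.le hmA0,
      mul_nonneg hd0.le hmP0, mul_pos hd0 hm]
  have hdAP : d * (A + P) * (m + 1) ≤ 1 / 8 := by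
    have : d * (A + P) * (m + 1) + d * (m + 1) = δ / 8 := by rw [← hdD, hD]; ring
    linarith [mul_pos hd0 hm]
  obtain ⟨κ₁, hκ₁⟩ : ∃ t, t = 1 + d / ε := ⟨_, rfl⟩
  obtain ⟨c₁, hc₁⟩ : ∃ t, t = δ / 2 / m := ⟨_, rfl⟩
  obtain ⟨c₂, hc₂⟩ : ∃ t, t = 1 / (4 * (m + 1)) := ⟨_, rfl⟩
  obtain ⟨N₁, hN₁⟩ : ∃ t, t = N + 4 * κ₁ / (δ / 4) / m := ⟨_, rfl⟩
  have hc₁0 : 0 < c₁ := by rw [hc₁]; positivity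
  have hc₂0 : 0 < c₂ := by rw [hc₂]; positivity
  have hκ₁0 : 0 < κ₁ := by rw [hκ₁]; positivity
  have hN₁0 : 0 < N₁ := by rw [hN₁]; positivity
  refine ⟨d, hd0, hd1, 2 / c₁ * (8 / c₁ + N₁) + 2 / c₂ * (8 / c₂ + N), by positivity, ?_⟩
  intro y h a μ T q ω Q hy hh ha hμ hQ hT hq hmain
  have hQ0 : 0 < Q := by rw [hQ]; positivity
  have hyQ : y ≤ Q := by linarith [mul_pos hd0 hh]
  have hQZ : Q ≤ y + h := by linarith [mul_le_mul_of_nonneg_right hd1 hh.le]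
  have hQZ2 : Q ^ 2 ≤ (y + h) ^ 2 := pow_le_pow_left₀ hQ0.le hQZ 2
  have hq' : q ^ 2 ≤ 16 * Q ^ 3 * ω ^ 2 := by
    refine hq.trans ?_
    have := mul_le_mul_of_nonneg_left hyQ (show 0 ≤ 16 * Q ^ 2 * ω ^ 2 by positivity)
    linarith
  have hsq : (-(y + h) - T) ^ 2 = (y + h + T) ^ 2 := by ring
  have hmain' : T ^ 2 + (y + h + T) ^ 2 / m - h * a * y + d / 2 * μ * (h * y)
      - d / 2 * h ^ 2 * a ≤ q + N * Q * ω ^ 2 := by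
    rw [hsq, hT] at hmain
    linarith
  rw [add_mul]
  rcases le_total (ε * h) y with hcase | hcase
  · have hy0 : 0 < y := lt_of_lt_of_le (by positivity) hcase
    have hQy : Q ≤ κ₁ * y := by
      rw [hQ, hκ₁]
      have : d / ε * (ε * h) ≤ d / ε * y := by gcongr
      have h2 : d / ε * (ε * h) = d * h := by field_simp
      linarith
    obtain ⟨τ, hτ⟩ : ∃ t, t = q / (2 * y) := ⟨_, rfl⟩
    have hTz : T = -(d * a / 2 * h) + τ := by
      rw [hτ]
      field_simp
      linarith
    have hτ2 : τ ^ 2 ≤ 4 * κ₁ * Q * ω ^ 2 := by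
      rw [hτ, div_pow, div_le_iff₀ (by positivity)]
      have h1 := mul_le_mul_of_nonneg_left hQy (show 0 ≤ 16 * Q * ω ^ 2 * y by positivity)
      linarith
    have hlow := quadratic_lower_bound_of_gradient (τ := τ) hm hA hP hd0
      (show 0 < δ / 4 by positivity) (by linarith) hdA hy hh.le ha hμ rfl
    have hcoef : δ / 2 ≤ 1 - δ / 4 - d * A - m * A / 4 - m * d * A / 2 - d * m * P / 8 := by
      have : d * ((m + 1) * (A + P + 1)) = δ / 8 := by rw [← hdD, hD]; ring
      linarith [mul_nonneg hd0.le hA, mul_nonneg hd0.le hP,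
        mul_nonneg hd0.le hmA0, mul_nonneg hd0.le hmP0, mul_pos hd0 hm]
    have h1 := mul_le_mul_of_nonneg_right hcoef (sq_nonneg (y + h))
    rw [show y + h - d * a / 2 * h + τ = y + h + T by rw [hTz]; ring] at hlow
    have h2 : δ / 2 * (y + h) ^ 2 / m ≤ ((y + h + T) ^ 2 + m * (-(h * a * y)
        + d / 2 * μ * (h * y) - d / 2 * h ^ 2 * a) + τ ^ 2 / (δ / 4)) / m := by
      gcongr
      linarith
    have h3 : ((y + h + T) ^ 2 + m * (-(h * a * y)
        + d / 2 * μ * (h * y) - d / 2 * h ^ 2 * a) + τ ^ 2 / (δ / 4)) / m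
        = (y + h + T) ^ 2 / m + (-(h * a * y)
        + d / 2 * μ * (h * y) - d / 2 * h ^ 2 * a) + τ ^ 2 / (δ / 4) / m := by
      field_simp
    have h4 : τ ^ 2 / (δ / 4) / m ≤ 4 * κ₁ * Q * ω ^ 2 / (δ / 4) / m := by gcongr
    have h5 : c₁ * Q ^ 2 ≤ q + N₁ * Q * ω ^ 2 := by
      have e1 : c₁ * (y + h) ^ 2 = δ / 2 * (y + h) ^ 2 / m := by rw [hc₁]; ring
      have e2 : N₁ * Q * ω ^ 2 = N * Q * ω ^ 2 + 4 * κ₁ * Q * ω ^ 2 / (δ / 4) / m := by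
        rw [hN₁]; ring
      have e3 := mul_le_mul_of_nonneg_left hQZ2 hc₁0.le
      linarith [sq_nonneg T]
    have h6 := le_of_mul_sq_le_add hc₁0 hQ0 hq' h5
    have h7 : 0 ≤ 2 / c₂ * (8 / c₂ + N) * ω ^ 2 := by positivity
    linarith
  · have hlow := quadratic_lower_bound_of_small_gradient (T := T) hm hA hP hd0 hε0.le hy hh.le
      hcase ha hμ
    have hcoef : c₂ ≤ 1 / (m + 1) - A * ε - d / 2 * P * ε - d / 2 * A := by
      have e1 : A * ε ≤ 1 / (4 * (m + 1)) := by
        rw [hε, mul_one_div, div_le_div_iff₀ (by positivity) (by positivity)]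
        linarith
      have e2 : ε ≤ 1 := by
        rw [hε, div_le_one (by positivity)]
        linarith [mul_nonneg hm.le hA]
      have e3 : d / 2 * P * ε + d / 2 * A ≤ 1 / (4 * (m + 1)) := by
        have f1 : d / 2 * P * ε ≤ d / 2 * P * 1 :=
          mul_le_mul_of_nonneg_left e2 (by positivity)
        have f2 : d / 2 * (A + P) ≤ 1 / (4 * (m + 1)) := by
          rw [le_div_iff₀ (by positivity)]
          linarith
        linarith
      have e4 : 1 / (m + 1) = 4 * c₂ := by rw [hc₂]; field_simp
      rw [e4]
      linarith
    have h1 := mul_le_mul_of_nonneg_right hcoef (sq_nonneg (y + h))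
    have h5 : c₂ * Q ^ 2 ≤ q + N * Q * ω ^ 2 := by
      have e3 := mul_le_mul_of_nonneg_left hQZ2 hc₂0.le
      linarith
    have h6 := le_of_mul_sq_le_add hc₂0 hQ0 hq' h5
    have h7 : 0 ≤ 2 / c₁ * (8 / c₁ + N₁) * ω ^ 2 := by positivity
    linarith

end Algebra

section Calculus

variable {n : ℕ}

lemma lap_add {g h : E n → ℝ} {x : E n} (hg : ContDiffAt ℝ 2 g x) (hh : ContDiffAt ℝ 2 h x) :
    lap (fun z => g z + h z) x = lap g x + lap h x := by
  unfold lap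
  rw [← Finset.sum_add_distrib]
  refine Finset.sum_congr rfl fun i _ => ?_
  rw [show (fun z => g z + h z) = g + h from rfl, iteratedFDeriv_add_apply hg hh]
  rfl

lemma lap_const_mul (c : ℝ) {g : E n → ℝ} {x : E n} (hg : ContDiffAt ℝ 2 g x) :
    lap (fun z => c * g z) x = c * lap g x := by
  unfold lap
  rw [Finset.mul_sum]
  refine Finset.sum_congr rfl fun i _ => ?_
  rw [show (fun z => c * g z) = c • g from rfl, iteratedFDeriv_const_smul_apply hg]
  rfl

lemma fderiv_apply_gradient (g : E n → ℝ) (x : E n) :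
    fderiv ℝ g x (gradient g x) = ‖gradient g x‖ ^ 2 := by
  rw [← real_inner_self_eq_norm_sq, gradient, InnerProductSpace.toDual_symm_apply]

lemma ContDiffAt.hasStrictFDerivAt_norm_gradient_sq {w : E n → ℝ} {x : E n}
    (hw : ContDiffAt ℝ 2 w x) :
    ∃ G : E n →L[ℝ] ℝ, HasStrictFDerivAt (fun z => ‖gradient w z‖ ^ 2) G x ∧
      ∀ a, G a = 2 * fderiv ℝ (fderiv ℝ w) x a (gradient w x) := by
  have h1 : HasStrictFDerivAt (fderiv ℝ w) (fderiv ℝ (fderiv ℝ w) x) x :=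
    (hw.fderiv_right (m := 1) (by norm_num)).hasStrictFDerivAt one_ne_zero
  have h2 : (fun z => ‖gradient w z‖ ^ 2) = fun z => ∑ i : Fin n,
      fderiv ℝ w z (EuclideanSpace.single i 1) * fderiv ℝ w z (EuclideanSpace.single i 1) := by
    ext z
    rw [norm_gradient, sum_sq_apply_single]
  have h3 : ∀ i : Fin n, gradient w x i = fderiv ℝ w x (EuclideanSpace.single i 1) := by
    intro i
    rw [gradient, ← InnerProductSpace.toDual_symm_apply, EuclideanSpace.inner_single_right]
    simp
  have h4 := fun i : Fin n => h1.clm_apply (hasStrictFDerivAt_const (EuclideanSpace.single i 1) x)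
  rw [h2]
  refine ⟨_, HasStrictFDerivAt.fun_sum fun i _ => (h4 i).mul (h4 i), fun a => ?_⟩
  rw [← sum_coord_mul_apply_single (fderiv ℝ (fderiv ℝ w) x a), Finset.mul_sum]
  simp only [_root_.sum_apply, h3]
  refine Finset.sum_congr rfl fun i _ => ?_
  simp
  ring

end Calculus

section Reaction

variable {f : ℝ → ℝ}

lemma hasDerivAt_div_self {t : ℝ} (hf : DifferentiableAt ℝ f t) (ht : t ≠ 0) :
    HasDerivAt (fun s => f s / s) ((t * deriv f t - f t) / t ^ 2) t := by
  refine (hf.hasDerivAt.div (hasDerivAt_id t) ht).congr_deriv ?_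
  simp [mul_comm]

lemma deriv_deriv_div_self (hf : ContDiffOn ℝ 2 f (Ioi 0)) {t : ℝ} (ht : 0 < t) :
    deriv (deriv fun s => f s / s) t
      = (t ^ 2 * deriv (deriv f) t - 2 * (t * deriv f t - f t)) / t ^ 3 := by
  have hfs : ∀ s ∈ Ioi (0 : ℝ), ContDiffAt ℝ 2 f s := fun s hs => hf.contDiffAt (Ioi_mem_nhds hs)
  have h1 : deriv (fun s => f s / s) =ᶠ[𝓝 t] fun s => (s * deriv f s - f s) / s ^ 2 := by
    filter_upwards [Ioi_mem_nhds ht] with s hs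
    exact (hasDerivAt_div_self ((hfs s hs).differentiableAt two_ne_zero) (ne_of_gt hs)).deriv
  rw [h1.deriv_eq]
  have h2 : HasDerivAt f (deriv f t) t := ((hfs t ht).differentiableAt two_ne_zero).hasDerivAt
  have h3 : HasDerivAt (deriv f) (deriv (deriv f) t) t := by
    exact (hfs t ht).differentiableAt_deriv.hasDerivAt
  have h4 := (((hasDerivAt_id t).mul h3).sub h2).div ((hasDerivAt_id t).pow 2)
    (pow_ne_zero 2 ht.ne')
  refine (h4.congr_deriv ?_).deriv
  simp
  field_simp

end Reaction

section Equation

variable {n : ℕ}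

lemma fderiv_log_comp {u : E n → ℝ} {x : E n} (hu : DifferentiableAt ℝ u x)
    (hpos : 0 < u x) :
    fderiv ℝ (fun z => Real.log (u z)) x = (u x)⁻¹ • fderiv ℝ u x :=
  (hu.hasFDerivAt.log hpos.ne').fderiv

lemma norm_gradient_log_sq {u : E n → ℝ} {x : E n} (hu : DifferentiableAt ℝ u x)
    (hpos : 0 < u x) :
    ‖gradient (fun z => Real.log (u z)) x‖ ^ 2 = ‖gradient u x‖ ^ 2 / u x ^ 2 := by
  rw [norm_gradient, norm_gradient, fderiv_log_comp hu hpos, norm_smul, mul_pow, norm_inv,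
    Real.norm_of_nonneg hpos.le]
  field_simp

lemma lap_log {u : E n → ℝ} {x : E n} (hu : ContDiffAt ℝ 2 u x) (hpos : 0 < u x) :
    lap (fun z => Real.log (u z)) x
      = lap u x / u x - ‖gradient (fun z => Real.log (u z)) x‖ ^ 2 := by
  rw [lap_comp (Real.contDiffAt_log.2 hpos.ne') hu,
    norm_gradient_log_sq (hu.differentiableAt two_ne_zero) hpos]
  simp [Real.deriv_log', deriv_inv]
  field_simp
  ring

/-- The Bernstein inequality at a local maximum of `|∇ log u|² + d f(u)/u + ψ` for a positive
solution of `Δu + f(u) = 0`. Here `T` is a second directional derivative of `log u`. -/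
theorem log_gradient_inequality_of_local_max (hn : 0 < n) {f : ℝ → ℝ}
    (hf : ContDiffOn ℝ 2 f (Ioi 0)) (hfpos : ∀ t, 0 < t → 0 < f t) {u ψ : E n → ℝ} {x : E n}
    {d m M : ℝ} (hu : ∀ᶠ z in 𝓝 x, ContDiffAt ℝ 2 u z ∧ 0 < u z ∧ lap u z + f (u z) = 0)
    (hψ : ContDiffAt ℝ 2 ψ x) (hm : 0 < m) (hnm : (n : ℝ) - 1 ≤ m)
    (hle : ∀ᶠ z in 𝓝 x,
      ‖gradient (fun z => Real.log (u z)) z‖ ^ 2 + (d * (f (u z) / u z) + ψ z) ≤ M)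
    (heq : ‖gradient (fun z => Real.log (u z)) x‖ ^ 2 + (d * (f (u x) / u x) + ψ x) = M)
    {y h a μ : ℝ} (hy : y = ‖gradient (fun z => Real.log (u z)) x‖ ^ 2) (hh : h = f (u x) / u x)
    (ha : a = u x * deriv f (u x) / f (u x) - 1)
    (hμ : μ = u x ^ 2 * deriv (deriv f) (u x) / f (u x)) :
    ∃ T : ℝ,
      2 * (y * T) = -(d * h * a * y)
        - fderiv ℝ ψ x (gradient (fun z => Real.log (u z)) x) ∧
      T ^ 2 + (-(y + h) - T) ^ 2 / m + -(2 * (y * T) + h * a * y)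
        + d / 2 * (h * y * (μ - 2 * a) - h ^ 2 * a) ≤ -(lap ψ x / 2) := by
  obtain ⟨hux, hpos, heqn⟩ := hu.self_of_nhds
  have hfu := hfpos _ hpos
  have hfx : ContDiffAt ℝ 2 f (u x) := hf.contDiffAt (Ioi_mem_nhds hpos)
  have hudiff := hux.differentiableAt two_ne_zero
  set w : E n → ℝ := fun z => Real.log (u z) with hw_def
  set v := gradient w x with hv
  have hw : ContDiffAt ℝ 2 w x := hux.log hpos.ne'
  have hφ : ContDiffAt ℝ 2 (fun s => f s / s) (u x) := hfx.div contDiffAt_id hpos.ne'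
  have hhC : ContDiffAt ℝ 2 (fun z => f (u z) / u z) x := hφ.comp x hux
  have hgu : ‖gradient u x‖ ^ 2 = u x ^ 2 * y := by
    rw [hy, norm_gradient_log_sq hudiff hpos]
    field_simp
  have hfh : f (u x) = u x * h := by rw [hh]; field_simp
  have hfa : u x * deriv f (u x) = u x * h * (a + 1) := by rw [← hfh, ha]; field_simp; ring
  have hfμ : u x ^ 2 * deriv (deriv f) (u x) = u x * h * μ := by rw [← hfh, hμ]; field_simp
  have hdh : ∀ b, fderiv ℝ (fun z => f (u z) / u z) x b = h * a * fderiv ℝ w x b := by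
    intro b
    have h1 : HasFDerivAt (fun z => f (u z) / u z) _ x :=
      (hasDerivAt_div_self (hfx.differentiableAt two_ne_zero) hpos.ne').comp_hasFDerivAt x
        hudiff.hasFDerivAt
    rw [h1.fderiv, fderiv_log_comp hudiff hpos, hfa, hfh]
    simp only [_root_.smul_apply, smul_eq_mul]
    field_simp
    ring
  have hlaph : lap (fun z => f (u z) / u z) x = h * y * (μ - 2 * a) - h ^ 2 * a := by
    rw [lap_comp (φ := fun s => f s / s) hφ hux, deriv_deriv_div_self hf hpos,
      (hasDerivAt_div_self (hfx.differentiableAt two_ne_zero) hpos.ne').deriv, hgu,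
      eq_neg_of_add_eq_zero_left heqn, hfa, hfμ, hfh]
    field_simp
    ring
  have hlapw : lap w =ᶠ[𝓝 x] fun z => -(‖gradient w z‖ ^ 2 + f (u z) / u z) := by
    filter_upwards [hu] with z hz
    rw [lap_log hz.1 hz.2.1, eq_neg_of_add_eq_zero_left hz.2.2]
    ring
  obtain ⟨G, hG, hGa⟩ := hw.hasStrictFDerivAt_norm_gradient_sq
  have hg := ((hG.add (hhC.hasStrictFDerivAt two_ne_zero)).neg).congr_of_eventuallyEq hlapw.symm
  have hκ : ContDiffAt ℝ 2 (fun z => d * (f (u z) / u z) + ψ z) x :=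
    (contDiffAt_const.mul hhC).add hψ
  have hcrit : G v + (d * (h * a * y) + fderiv ℝ ψ x v) = 0 := by
    have hmax : IsLocalMax
        (fun z => ‖gradient w z‖ ^ 2 + (d * (f (u z) / u z) + ψ z)) x := by
      filter_upwards [hle] with z hz
      rw [heq]
      exact hz
    have h1 := hmax.hasFDerivAt_eq_zero (hG.hasFDerivAt.add
      (((hhC.differentiableAt two_ne_zero).hasFDerivAt.const_mul d).add
        (hψ.differentiableAt two_ne_zero).hasFDerivAt))
    have h2 := congrArg (fun L : E n →L[ℝ] ℝ => L v) h1
    simp only [_root_.add_apply, _root_.smul_apply, smul_eq_mul, _root_.zero_apply] at h2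
    rw [hdh, fderiv_apply_gradient, ← hy] at h2
    exact h2
  obtain ⟨e, he, hev⟩ : ∃ e : E n, ‖e‖ = 1 ∧
      fderiv ℝ (fderiv ℝ w) x v v = y * fderiv ℝ (fderiv ℝ w) x e e := by
    rcases eq_or_ne v 0 with h0 | h0
    · refine ⟨EuclideanSpace.single ⟨0, hn⟩ 1, by simp, ?_⟩
      rw [hy, h0]
      simp
    · have : ‖v‖ ≠ 0 := norm_ne_zero_iff.2 h0
      refine ⟨‖v‖⁻¹ • v, by rw [norm_smul, norm_inv, norm_norm, inv_mul_cancel₀ this], ?_⟩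
      rw [hy]
      simp only [map_smul, _root_.smul_apply, smul_eq_mul]
      field_simp
  have key := bernstein_maximum_principle_direction hw hκ hg hle heq he hm hnm
  have hlapx : lap w x = -(y + h) := by
    rw [hlapw.self_of_nhds, hy, hh]
  rw [lap_add (contDiffAt_const.mul hhC) hψ, lap_const_mul d hhC, hlaph, hlapx] at key
  simp only [_root_.neg_apply, _root_.add_apply] at key
  rw [hdh, fderiv_apply_gradient, ← hv, ← hy, hGa, ← hv, hev] at key
  rw [hGa, ← hv, hev] at hcrit
  refine ⟨fderiv ℝ (fderiv ℝ w) x e e, by linarith, ?_⟩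
  linarith

end Equation

section Cutoff

variable {n : ℕ}

/-- The quadratic cutoff function of the ball `B(x₀, ρ)`. -/
noncomputable def cutoff (x₀ : E n) (ρ : ℝ) (z : E n) : ℝ := 1 - ‖z - x₀‖ ^ 2 / ρ ^ 2

lemma contDiff_cutoff (x₀ : E n) (ρ : ℝ) : ContDiff ℝ 2 (cutoff x₀ ρ) := by
  unfold cutoff
  exact contDiff_const.sub (((contDiff_id.sub contDiff_const).norm_sq ℝ).div_const _)

lemma cutoff_pos {x₀ z : E n} {ρ : ℝ} (hz : z ∈ ball x₀ ρ) : 0 < cutoff x₀ ρ z := by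
  rw [mem_ball_iff_norm] at hz
  have hρ : 0 < ρ := (norm_nonneg _).trans_lt hz
  rw [cutoff, sub_pos, div_lt_one (by positivity)]
  exact pow_lt_pow_left₀ hz (norm_nonneg _) two_ne_zero

lemma cutoff_le_one (x₀ z : E n) (ρ : ℝ) : cutoff x₀ ρ z ≤ 1 := by
  unfold cutoff
  have : 0 ≤ ‖z - x₀‖ ^ 2 / ρ ^ 2 := by positivity
  linarith

lemma fderiv_cutoff (x₀ z : E n) (ρ : ℝ) :
    fderiv ℝ (cutoff x₀ ρ) z = -(2 / ρ ^ 2) • innerSL ℝ (z - x₀) := by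
  have h1 : HasFDerivAt (fun z : E n => z - x₀) (ContinuousLinearMap.id ℝ (E n)) z :=
    (hasFDerivAt_id z).sub_const x₀
  have h2 := (h1.norm_sq.mul_const (ρ ^ 2)⁻¹).const_sub 1
  have h3 : cutoff x₀ ρ = fun z => 1 - ‖z - x₀‖ ^ 2 * (ρ ^ 2)⁻¹ := by
    ext z
    rw [cutoff, div_eq_mul_inv]
  rw [h3, h2.fderiv]
  ext a
  simp
  ring

lemma lap_cutoff (x₀ z : E n) (ρ : ℝ) : lap (cutoff x₀ ρ) z = -(2 * n / ρ ^ 2) := by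
  have h1 : fderiv ℝ (cutoff x₀ ρ) = fun z => (-(2 / ρ ^ 2) • innerSL ℝ) (z - x₀) := by
    ext z
    rw [fderiv_cutoff]
    rfl
  have h2 : fderiv ℝ (fderiv ℝ (cutoff x₀ ρ)) z = -(2 / ρ ^ 2) • innerSL ℝ := by
    rw [h1]
    exact ((ContinuousLinearMap.hasFDerivAt _).comp z ((hasFDerivAt_id z).sub_const x₀)).fderiv
  have h3 : ∀ a : E n, (-(2 / ρ ^ 2) • innerSL ℝ : E n →L[ℝ] E n →L[ℝ] ℝ) a a
      = -(2 / ρ ^ 2) * ‖a‖ ^ 2 := fun a => by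
    rw [← real_inner_self_eq_norm_sq]
    rfl
  rw [lap_eq_sum, h2]
  simp only [h3]
  simp
  ring

/-- Derivative bounds for the barrier `-M / σ²` at a point where `M = σ² Q`. -/
lemma cutoff_barrier_estimates {x₀ z : E n} {ρ Q M : ℝ} (hz : z ∈ ball x₀ ρ) (hQ : 0 ≤ Q)
    (hM : M = cutoff x₀ ρ z ^ 2 * Q) :
    ContDiffAt ℝ 2 (fun z => -M * (cutoff x₀ ρ z ^ 2)⁻¹) z ∧
    (∀ v, fderiv ℝ (fun z => -M * (cutoff x₀ ρ z ^ 2)⁻¹) z v ^ 2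
      ≤ 16 * Q ^ 2 * (1 / (ρ * cutoff x₀ ρ z)) ^ 2 * ‖v‖ ^ 2) ∧
    -(lap (fun z => -M * (cutoff x₀ ρ z ^ 2)⁻¹) z / 2)
      ≤ (2 * n + 12) * Q * (1 / (ρ * cutoff x₀ ρ z)) ^ 2 := by
  have hσ := cutoff_pos hz
  have hσ1 := cutoff_le_one x₀ z ρ
  have hC := (contDiff_cutoff x₀ ρ).contDiffAt (x := z)
  have hfd := fderiv_cutoff x₀ z ρ
  have hlap := lap_cutoff x₀ z ρ
  rw [mem_ball_iff_norm] at hz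
  have hρ : 0 < ρ := (norm_nonneg _).trans_lt hz
  have hgrad : ‖fderiv ℝ (cutoff x₀ ρ) z‖ ≤ 2 / ρ := by
    rw [hfd, norm_smul, innerSL_apply_norm, norm_neg, Real.norm_of_nonneg (by positivity)]
    calc 2 / ρ ^ 2 * ‖z - x₀‖ ≤ 2 / ρ ^ 2 * ρ := by gcongr
      _ = 2 / ρ := by field_simp
  have hder : ∀ s : ℝ, s ≠ 0 →
      HasDerivAt (fun s : ℝ => -M * (s ^ 2)⁻¹) (2 * M * (s ^ 3)⁻¹) s := by
    intro s hs
    refine (((hasDerivAt_pow 2 s).inv (pow_ne_zero 2 hs)).const_mul (-M)).congr_deriv ?_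
    simp
    field_simp
  have hder2 : ∀ s : ℝ, s ≠ 0 →
      deriv (deriv fun s : ℝ => -M * (s ^ 2)⁻¹) s = -(6 * M) * (s ^ 4)⁻¹ := by
    intro s hs
    have h1 : deriv (fun s : ℝ => -M * (s ^ 2)⁻¹) =ᶠ[𝓝 s] fun s => 2 * M * (s ^ 3)⁻¹ := by
      filter_upwards [isOpen_ne.mem_nhds hs] with t ht
      exact (hder t ht).deriv
    rw [h1.deriv_eq]
    refine ((((hasDerivAt_pow 3 s).inv (pow_ne_zero 3 hs)).const_mul (2 * M)).congr_deriv ?_).deriv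
    simp
    field_simp
    ring
  have hφ : ContDiffAt ℝ 2 (fun s : ℝ => -M * (s ^ 2)⁻¹) (cutoff x₀ ρ z) :=
    contDiffAt_const.mul ((contDiffAt_id.pow 2).inv (pow_ne_zero 2 hσ.ne'))
  refine ⟨hφ.comp z hC, fun v => ?_, ?_⟩
  · have h1 : HasFDerivAt (fun z => -M * (cutoff x₀ ρ z ^ 2)⁻¹) _ z :=
      (hder _ hσ.ne').comp_hasFDerivAt z (hC.differentiableAt two_ne_zero).hasFDerivAt
    have h2 : fderiv ℝ (cutoff x₀ ρ) z v ^ 2 ≤ (2 / ρ * ‖v‖) ^ 2 := by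
      rw [← sq_abs]
      exact pow_le_pow_left₀ (abs_nonneg _) (ContinuousLinearMap.le_of_opNorm_le _ hgrad v) 2
    rw [h1.fderiv, hM]
    simp only [_root_.smul_apply, smul_eq_mul]
    generalize cutoff x₀ ρ z = s at *
    calc _ = (2 * Q / s) ^ 2 * fderiv ℝ (cutoff x₀ ρ) z v ^ 2 := by field_simp
      _ ≤ (2 * Q / s) ^ 2 * (2 / ρ * ‖v‖) ^ 2 := by gcongr
      _ = _ := by
        field_simp
        ring
  · rw [lap_comp (φ := fun s : ℝ => -M * (s ^ 2)⁻¹) hφ hC, hder2 _ hσ.ne',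
      (hder _ hσ.ne').deriv, hlap, hM, norm_gradient]
    have h2 : ‖fderiv ℝ (cutoff x₀ ρ) z‖ ^ 2 ≤ (2 / ρ) ^ 2 :=
      pow_le_pow_left₀ (norm_nonneg _) hgrad 2
    generalize ‖fderiv ℝ (cutoff x₀ ρ) z‖ ^ 2 = b at *
    generalize cutoff x₀ ρ z = s at *
    calc _ = Q / s ^ 2 * (2 * n * s / ρ ^ 2 + 3 * b) := by
          field_simp
          ring
      _ ≤ Q / s ^ 2 * (2 * n * 1 / ρ ^ 2 + 3 * (2 / ρ) ^ 2) := by gcongr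
      _ = _ := by
        field_simp
        ring

end Cutoff

section Estimate

variable {n : ℕ}

/-- Bernstein's estimate for the weighted quantity `σ² (|∇ log u|² + d f(u)/u)`, given an algebraic
bound at its maximum point. -/
theorem cutoff_sq_mul_log_gradient_le (hn : 0 < n) {A P m d C : ℝ} (hm : 0 < m)
    (hnm : (n : ℝ) - 1 ≤ m) (hd : 0 < d)
    (halg : ∀ y h a μ T q ω Q : ℝ,
      0 ≤ y → 0 < h → a ≤ A → -P ≤ μ → Q = y + d * h →
      2 * (y * T) = -(d * h * a * y) + q → q ^ 2 ≤ 16 * Q ^ 2 * ω ^ 2 * y →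
      T ^ 2 + (-(y + h) - T) ^ 2 / m + -(2 * (y * T) + h * a * y)
        + d / 2 * (h * y * (μ - 2 * a) - h ^ 2 * a) ≤ (2 * n + 12) * Q * ω ^ 2 →
      Q ≤ C * ω ^ 2)
    {f : ℝ → ℝ} (hf : ContDiffOn ℝ 2 f (Ioi 0)) (hfpos : ∀ t, 0 < t → 0 < f t)
    (hfA : ∀ t, 0 < t → t * deriv f t / f t - 1 ≤ A)
    (hfP : ∀ t, 0 < t → -P ≤ t ^ 2 * deriv (deriv f) t / f t)
    {x₀ : E n} {ρ r : ℝ} (hρ : 0 < ρ) (hρr : ρ < r) {u : E n → ℝ}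
    (hu : ContDiffOn ℝ 2 u (ball x₀ r)) (hupos : ∀ x ∈ ball x₀ r, 0 < u x)
    (heq : ∀ x ∈ ball x₀ r, lap u x + f (u x) = 0) {x : E n} (hx : x ∈ closedBall x₀ ρ) :
    cutoff x₀ ρ x ^ 2 * (‖gradient u x‖ ^ 2 / u x ^ 2 + d * (f (u x) / u x)) ≤ C / ρ ^ 2 := by
  have hsub : closedBall x₀ ρ ⊆ ball x₀ r := closedBall_subset_ball hρr
  have huC : ∀ z ∈ ball x₀ r, ContDiffAt ℝ 2 u z := fun z hz =>
    hu.contDiffAt (isOpen_ball.mem_nhds hz)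
  obtain ⟨F, hF⟩ : ∃ F : E n → ℝ, F = fun z =>
      cutoff x₀ ρ z ^ 2 * (‖gradient u z‖ ^ 2 / u z ^ 2 + d * (f (u z) / u z)) := ⟨_, rfl⟩
  have hFc : ContinuousOn F (closedBall x₀ ρ) := by
    intro z hz
    have hpos := hupos z (hsub hz)
    have hc := huC z (hsub hz)
    have h1 : ContinuousAt (fun z => ‖gradient u z‖) z := by
      simp only [norm_gradient]
      exact (hc.continuousAt_fderiv two_ne_zero).norm
    have h2 : ContinuousAt (fun z => f (u z)) z :=
      ContinuousAt.comp (g := f) (hf.contDiffAt (Ioi_mem_nhds hpos)).continuousAt hc.continuousAt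
    rw [hF]
    refine ContinuousAt.continuousWithinAt ?_
    exact ((contDiff_cutoff x₀ ρ).continuous.continuousAt.pow 2).mul
      (((h1.pow 2).div (hc.continuousAt.pow 2) (pow_ne_zero 2 hpos.ne')).add
        (continuousAt_const.mul (h2.div hc.continuousAt hpos.ne')))
  obtain ⟨p, hp, hmax⟩ := (isCompact_closedBall x₀ ρ).exists_isMaxOn
    ⟨x₀, mem_closedBall_self hρ.le⟩ hFc
  have hQpos : ∀ z ∈ ball x₀ r, 0 < ‖gradient u z‖ ^ 2 / u z ^ 2 + d * (f (u z) / u z) := by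
    intro z hz
    have h1 := hupos z hz
    have h2 := hfpos _ h1
    positivity
  have hF0 : 0 < F p := by
    refine lt_of_lt_of_le ?_ (hmax (mem_closedBall_self hρ.le))
    have h1 := hQpos x₀ (hsub (mem_closedBall_self hρ.le))
    have h2 := cutoff_pos (mem_ball_self (x := x₀) hρ)
    rw [hF]
    positivity
  have hpb : p ∈ ball x₀ ρ := by
    rcases (mem_closedBall.1 hp).lt_or_eq with h | h
    · exact h
    · exfalso
      rw [dist_eq_norm] at h
      have : cutoff x₀ ρ p = 0 := by
        rw [cutoff, h, div_self (pow_ne_zero 2 hρ.ne'), sub_self]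
      rw [hF] at hF0
      simp [this] at hF0
  have hpr := hsub hp
  have hσ := cutoff_pos hpb
  have hup := hupos p hpr
  have hlog : ∀ z ∈ ball x₀ r, ‖gradient (fun z => Real.log (u z)) z‖ ^ 2
      = ‖gradient u z‖ ^ 2 / u z ^ 2 := fun z hz =>
    norm_gradient_log_sq ((huC z hz).differentiableAt two_ne_zero) (hupos z hz)
  obtain ⟨Q, hQ⟩ : ∃ Q, Q = ‖gradient u p‖ ^ 2 / u p ^ 2 + d * (f (u p) / u p) := ⟨_, rfl⟩
  have hFp : F p = cutoff x₀ ρ p ^ 2 * Q := by rw [hF, hQ]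
  have hQ0 : 0 < Q := hQ ▸ hQpos p hpr
  obtain ⟨hψ, hψ1, hψ2⟩ := cutoff_barrier_estimates hpb hQ0.le hFp
  obtain ⟨T, hT1, hT2⟩ := log_gradient_inequality_of_local_max (d := d) (M := 0) hn hf hfpos
    (u := u) (x := p) (ψ := fun z => -F p * (cutoff x₀ ρ z ^ 2)⁻¹)
    (by
      filter_upwards [isOpen_ball.mem_nhds hpr] with z hz
      exact ⟨huC z hz, hupos z hz, heq z hz⟩)
    hψ hm hnm
    (by
      filter_upwards [isOpen_ball.mem_nhds hpb] with z hz
      have h1 := hmax (ball_subset_closedBall hz)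
      have h2 := cutoff_pos hz
      rw [hlog z (hsub (ball_subset_closedBall hz))]
      have h3 : F z * (cutoff x₀ ρ z ^ 2)⁻¹
          = ‖gradient u z‖ ^ 2 / u z ^ 2 + d * (f (u z) / u z) := by
        rw [hF]
        field_simp
      have h4 : F z * (cutoff x₀ ρ z ^ 2)⁻¹ ≤ F p * (cutoff x₀ ρ z ^ 2)⁻¹ := by
        gcongr
        exact h1
      linarith)
    (by
      rw [hlog p hpr, hFp, ← add_assoc, ← hQ]
      field_simp
      ring)
    rfl rfl rfl rfl
  have hmain := halg _ _ _ _ T _ (1 / (ρ * cutoff x₀ ρ p)) Q (sq_nonneg _)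
    (div_pos (hfpos _ hup) hup) (hfA _ hup) (hfP _ hup) (by rw [hlog p hpr, hQ]) hT1
    (by rw [neg_sq]; exact hψ1 _) (hT2.trans hψ2)
  have h1 : F x ≤ F p := hmax hx
  have h2 : F p ≤ C / ρ ^ 2 := by
    rw [hFp]
    calc _ ≤ cutoff x₀ ρ p ^ 2 * (C * (1 / (ρ * cutoff x₀ ρ p)) ^ 2) := by gcongr
      _ = C / ρ ^ 2 := by field_simp
  rw [hF] at h1 h2
  exact h1.trans h2

end Estimate

/-- logarithmic gradient and universal boundedness estimate for
`Δu + f(u) = 0` on Euclidean balls, for positive `f` with `sup t f'/f ≤ Λ₀ < p(n)`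
and `inf t² f''/f ≥ Pi₀`. -/
theorem stmt0 (n : ℕ) (hn : 0 < n) (Λ₀ Pi₀ : ℝ)
    (hΛp : 1 < n → Λ₀ < ((n : ℝ) + 3) / ((n : ℝ) - 1)) :
    ∃ C : ℝ, 0 < C ∧
      ∀ f : ℝ → ℝ, ContDiffOn ℝ 2 f (Ioi 0) →
        (∀ t : ℝ, 0 < t → 0 < f t) →
        (∀ t : ℝ, 0 < t → t * deriv f t / f t ≤ Λ₀) →
        (∀ t : ℝ, 0 < t → Pi₀ ≤ t ^ 2 * deriv (deriv f) t / f t) →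
        ∀ (x₀ : E n) (R : ℝ), 0 < R →
          ∀ u : E n → ℝ, ContDiffOn ℝ 2 u (ball x₀ (2 * R)) →
            (∀ x ∈ ball x₀ (2 * R), 0 < u x) →
            (∀ x ∈ ball x₀ (2 * R), lap u x + f (u x) = 0) →
            ∀ x ∈ ball x₀ R,
              ‖gradient u x‖ ^ 2 / (u x) ^ 2 + f (u x) / u x ≤ C / R ^ 2 := by
  obtain ⟨A, hA⟩ : ∃ A, A = max (Λ₀ - 1) 0 := ⟨_, rfl⟩
  have hA0 : 0 ≤ A := hA ▸ le_max_right _ _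
  have hΛA : Λ₀ - 1 ≤ A := hA ▸ le_max_left _ _
  obtain ⟨m, hm, hnm, hmA⟩ : ∃ m : ℝ, 0 < m ∧ (n : ℝ) - 1 ≤ m ∧ m * A < 4 := by
    rcases Nat.lt_or_ge 1 n with h1 | h1
    · have h2 : (0 : ℝ) < n - 1 := sub_pos.2 (by exact_mod_cast h1)
      refine ⟨n - 1, h2, le_rfl, ?_⟩
      rw [hA]
      rcases max_cases (Λ₀ - 1) 0 with ⟨h3, _⟩ | ⟨h3, _⟩
      · have h4 := (lt_div_iff₀ h2).1 (hΛp h1)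
        rw [h3]
        linarith
      · rw [h3]
        linarith
    · obtain rfl : n = 1 := le_antisymm h1 hn
      refine ⟨1 / (A + 1), by positivity, ?_, ?_⟩
      · rw [Nat.cast_one, sub_self]
        positivity
      · rw [one_div_mul_eq_div, div_lt_iff₀ (by positivity)]
        linarith
  obtain ⟨d, hd, hd1, C, hC, halg⟩ := exists_bound_of_max_point_inequality
    (N := 2 * n + 12) hm hA0 hmA (abs_nonneg Pi₀) (by positivity)
  refine ⟨36 / 25 * C / d, by positivity, ?_⟩
  intro f hf hfpos hfΛ hfPi x₀ R hR u hu hupos heq x hx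
  have hx' : x ∈ closedBall x₀ (3 / 2 * R) :=
    closedBall_subset_closedBall (by linarith) (ball_subset_closedBall hx)
  have hmain := cutoff_sq_mul_log_gradient_le hn hm hnm hd halg hf hfpos
    (fun t ht => (sub_le_sub_right (hfΛ t ht) 1).trans hΛA)
    (fun t ht => (neg_abs_le Pi₀).trans (hfPi t ht)) (show 0 < 3 / 2 * R by positivity)
    (show 3 / 2 * R < 2 * R by linarith) hu hupos heq hx'
  have hxu := hupos x (ball_subset_ball (by linarith) hx)
  have hfu := hfpos _ hxu
  have hσ : 5 / 9 ≤ cutoff x₀ (3 / 2 * R) x := by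
    have h1 : ‖x - x₀‖ ^ 2 / (3 / 2 * R) ^ 2 ≤ R ^ 2 / (3 / 2 * R) ^ 2 := by
      have := (mem_ball_iff_norm.1 hx).le
      gcongr
    have h2 : R ^ 2 / (3 / 2 * R) ^ 2 = 4 / 9 := by
      field_simp
      norm_num
    rw [cutoff]
    linarith
  have hy : 0 ≤ ‖gradient u x‖ ^ 2 / u x ^ 2 := by positivity
  have hh : 0 < f (u x) / u x := by positivity
  generalize ‖gradient u x‖ ^ 2 / u x ^ 2 = y at *
  generalize f (u x) / u x = h at *
  have h1 : d * (y + h) ≤ y + d * h := by nlinarith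
  have h2 : (5 / 9) ^ 2 * (d * (y + h)) ≤ C / (3 / 2 * R) ^ 2 := by
    refine le_trans ?_ hmain
    gcongr
  have h3 : C / (3 / 2 * R) ^ 2 = (5 / 9) ^ 2 * (d * (36 / 25 * C / d / R ^ 2)) := by
    field_simp
    norm_num
  rw [h3] at h2
  exact le_of_mul_le_mul_left (le_of_mul_le_mul_left h2 (by norm_num)) hd
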